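/- Let X be a compact metric space which is a topological n-manifold without boundary (i.e. X is a charted space modeled on the Euclidean space ℝⁿ). Then there exists ε > 0 such that every continuous map f : X → X satisfying dist(f(x), x) < ε for all x ∈ X is surjective. -/

import Mathlib

open MeasureTheory Metric Set Filter Topology
open scoped NNReal

section NoRetraction

variable {E : Type*} [NormedAddCommGroup E] [NormedSpace ℝ E]

/-- A map which is Lipschitz on the closed unit ball and vanishes on the unit sphere stays Lipschitz,
with the same constant, when it is extended by zero. -/
lemma LipschitzOnWith.lipschitzWith_indicator_closedBall {F : Type*} [NormedAddCommGroup F]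
    {u : E → F} {K : ℝ≥0} (hu : LipschitzOnWith K u (closedBall 0 1))
    (h0 : ∀ x, ‖x‖ = 1 → u x = 0) :
    LipschitzWith K ((closedBall (0 : E) 1).indicator u) := by
  have key : ∀ x y : E, ‖x‖ ≤ 1 → 1 < ‖y‖ → ‖u x‖ ≤ K * ‖x - y‖ := by
    intro x y hx hy
    have hc : ContinuousOn (fun s : ℝ => ‖AffineMap.lineMap x y s‖) (Icc 0 1) := by
      apply Continuous.continuousOn
      exact (AffineMap.lineMap_continuous).norm
    obtain ⟨s, hs, hs1⟩ := intermediate_value_Icc zero_le_one hc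
      (show (1 : ℝ) ∈ Icc _ _ by simpa using ⟨hx, hy.le⟩)
    have h1 := hu.dist_le_mul x (by simpa using hx) (AffineMap.lineMap x y s)
      (by simpa using hs1.le)
    rw [h0 _ hs1, dist_zero_right, dist_left_lineMap, dist_eq_norm x y, Real.norm_eq_abs,
      abs_of_nonneg hs.1] at h1
    refine h1.trans ?_
    gcongr
    exact mul_le_of_le_one_left (norm_nonneg _) hs.2
  refine LipschitzWith.of_dist_le_mul fun x y => ?_
  by_cases hx : x ∈ closedBall (0 : E) 1 <;> by_cases hy : y ∈ closedBall (0 : E) 1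
  · simpa [hx, hy] using hu.dist_le_mul x hx y hy
  · rw [indicator_of_mem hx, indicator_of_notMem hy, dist_zero_right, dist_eq_norm]
    exact key x y (by simpa using hx) (by simpa using hy)
  · rw [indicator_of_mem hy, indicator_of_notMem hx, dist_zero_left, dist_eq_norm, norm_sub_rev]
    exact key y x (by simpa using hy) (by simpa using hx)
  · simp only [indicator_of_notMem hx, indicator_of_notMem hy, dist_self]
    positivity

/-- If a self-map `F` of the closed unit ball fixes the unit sphere and `F - id` is `K`-Lipschitz,
then the straight-line homotopy from the identity to `F` is a bijection of the ball at all times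
`t` with `t * K < 1`. -/
lemma bijOn_closedBall_add_smul_sub [CompleteSpace E] {F : E → E} {K : ℝ≥0}
    (hu : LipschitzOnWith K (fun x => F x - x) (closedBall 0 1))
    (h0 : ∀ x, ‖x‖ = 1 → F x = x) (hF : MapsTo F (closedBall 0 1) (closedBall 0 1))
    {t : ℝ} (ht0 : 0 ≤ t) (ht1 : t ≤ 1) (htK : t * K < 1) :
    BijOn (fun x => x + t • (F x - x)) (closedBall 0 1) (closedBall 0 1) := by
  have hv := hu.lipschitzWith_indicator_closedBall fun x hx => by simp [h0 x hx]
  set v := (closedBall (0 : E) 1).indicator fun x => F x - x with hvdef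
  refine ⟨fun x hx => ?_, fun x hx y hy hxy => ?_, fun y hy => ?_⟩
  · have := (convex_closedBall (0 : E) 1) hx (hF hx) (sub_nonneg.2 ht1) ht0 (by ring)
    convert this using 1
    module
  · have h1 := hu.dist_le_mul x hx y hy
    have h2 : x - y = -(t • ((F x - x) - (F y - y))) := by
      have : x + t • (F x - x) = y + t • (F y - y) := hxy
      rw [smul_sub t (F x - x), neg_sub, sub_eq_sub_iff_add_eq_add, this, add_comm]
    have h3 : dist x y = t * dist (F x - x) (F y - y) := by
      rw [dist_eq_norm, h2, norm_neg, norm_smul, Real.norm_eq_abs, abs_of_nonneg ht0, dist_eq_norm]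
    have h4 : dist x y ≤ t * K * dist x y := by
      rw [mul_assoc]; nth_rw 1 [h3]; gcongr
    have h5 : dist x y ≤ 0 := by nlinarith [dist_nonneg (x := x) (y := y)]
    exact dist_le_zero.1 h5
  · have hc : ContractingWith (t.toNNReal * K) (fun x => y - t • v x) := by
      refine ⟨?_, LipschitzWith.of_dist_le_mul fun a b => ?_⟩
      · rw [← NNReal.coe_lt_coe]
        simpa [Real.coe_toNNReal t ht0] using htK
      · rw [dist_sub_left, dist_smul₀, Real.norm_eq_abs, abs_of_nonneg ht0, NNReal.coe_mul,
          Real.coe_toNNReal t ht0, mul_assoc]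
        gcongr
        exact hv.dist_le_mul a b
    obtain ⟨x, hx, -⟩ := hc.exists_fixedPoint y (edist_ne_top _ _)
    have hx' : y - t • v x = x := hx
    by_cases hxB : x ∈ closedBall (0 : E) 1
    · refine ⟨x, hxB, ?_⟩
      rw [hvdef, indicator_of_mem hxB] at hx'
      change x + t • (F x - x) = y
      nth_rw 1 [← hx']
      abel
    · rw [hvdef, indicator_of_notMem hxB, smul_zero, sub_zero] at hx'
      exact absurd (hx' ▸ hy) hxB

variable [FiniteDimensional ℝ E]

/-- The determinant of `1 + t • L` is polynomial in `t`, of degree at most the dimension. -/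
lemma exists_polynomial_eval_eq_det_one_add_smul (L : E →L[ℝ] E) :
    ∃ p : Polynomial ℝ, p.natDegree ≤ Module.finrank ℝ E ∧
      ∀ t : ℝ, p.eval t = (1 + t • L).det := by
  classical
  let b := Module.finBasis ℝ E
  let A := LinearMap.toMatrix b b (L : E →ₗ[ℝ] E)
  refine ⟨_, (Polynomial.natDegree_det_X_add_C_le A 1).trans (by simp), fun t => ?_⟩
  rw [← Polynomial.coe_evalRingHom, RingHom.map_det, ContinuousLinearMap.det,
    ← LinearMap.det_toMatrix b]
  congr 1
  ext i j
  simp [A, Matrix.one_apply, LinearMap.toMatrix_apply, Finsupp.single_apply, eq_comm, add_comm]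
  split_ifs <;> simp [mul_comm]

/-- The value at `1` of the polynomial `t ↦ det (1 + t • L)` is an affine combination, with weights
independent of `L`, of its values at arbitrarily small positive times. -/
lemma exists_affine_combination_det_one_add_smul {δ : ℝ} (hδ : 0 < δ) :
    ∃ (s : Finset ℕ) (v w : ℕ → ℝ), (∀ i ∈ s, 0 < v i ∧ v i ≤ δ) ∧ ∑ i ∈ s, w i = 1 ∧
      ∀ L : E →L[ℝ] E, (1 + L).det = ∑ i ∈ s, w i * (1 + v i • L).det := by
  let s := Finset.range (Module.finrank ℝ E + 1)
  let v : ℕ → ℝ := fun i => δ / (i + 1)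
  have hv : Set.InjOn v s := by
    intro i _ j _ hij
    simp only [v] at hij
    field_simp at hij
    exact_mod_cast add_right_cancel hij.symm
  refine ⟨s, v, fun i => (Lagrange.basis s v i).eval 1, fun i _ => ⟨by positivity, ?_⟩, ?_,
    fun L => ?_⟩
  · exact div_le_self hδ.le (by simp)
  · rw [← Polynomial.eval_finsetSum, Lagrange.sum_basis hv ⟨0, by simp [s]⟩, Polynomial.eval_one]
  · obtain ⟨p, hp, hpL⟩ := exists_polynomial_eval_eq_det_one_add_smul L
    have hdeg : p.degree < s.card := by
      refine lt_of_le_of_lt Polynomial.degree_le_natDegree ?_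
      simp only [s, Finset.card_range]
      exact_mod_cast Nat.lt_succ_of_le hp
    have h1 : (1 + L).det = p.eval 1 := by rw [hpL, one_smul]
    rw [h1, Lagrange.eq_interpolate hv hdeg, Lagrange.interpolate_apply,
      Polynomial.eval_finsetSum]
    refine Finset.sum_congr rfl fun i _ => ?_
    rw [Polynomial.eval_mul, Polynomial.eval_C, hpL, mul_comm]

end NoRetraction

section Inner

variable {E : Type*} [NormedAddCommGroup E] [InnerProductSpace ℝ E]

/-- The derivative of a map to the unit sphere is singular. -/
lemma det_fderiv_eq_zero_of_norm_eq_one [FiniteDimensional ℝ E] {F : E → E} {x : E}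
    (hF : DifferentiableAt ℝ F x)
    (hn : ∀ᶠ y in 𝓝 x, ‖F y‖ = 1) : (fderiv ℝ F x).det = 0 := by
  by_contra hdet
  have hx : ‖F x‖ = 1 := hn.self_of_nhds
  have horth : ∀ v, inner ℝ (F x) (fderiv ℝ F x v) = 0 := by
    intro v
    have h1 := (hF.hasFDerivAt.norm_sq)
    have h2 : HasFDerivAt (fun y => ‖F y‖ ^ 2) (0 : E →L[ℝ] ℝ) x := by
      refine (hasFDerivAt_const (1 : ℝ) x).congr_of_eventuallyEq ?_
      filter_upwards [hn] with y hy
      simp [hy]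
    have h3 := DFunLike.congr_fun (h1.unique h2) v
    simpa using h3
  have hsurj : Function.Surjective (fderiv ℝ F x) :=
    ((Module.End.isUnit_iff _).1 ((LinearMap.isUnit_iff_isUnit_det (fderiv ℝ F x : E →ₗ[ℝ] E)).2
      (isUnit_iff_ne_zero.2 hdet))).2
  obtain ⟨v, hv⟩ := hsurj (F x)
  have := horth v
  rw [hv, real_inner_self_eq_norm_sq, hx] at this
  norm_num at this


variable [FiniteDimensional ℝ E]

/-- There is no `C¹` map to the unit sphere which fixes the unit sphere. -/
theorem exists_norm_ne_one_of_contDiff {F : E → E} (hF : ContDiff ℝ 1 F)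
    (h0 : ∀ x, ‖x‖ = 1 → F x = x) : ∃ x, ‖F x‖ ≠ 1 := by
  by_contra! hn
  let _ : MeasurableSpace E := borel E
  have : BorelSpace E := ⟨rfl⟩
  let B : Set E := closedBall 0 1
  have hB : IsCompact B := isCompact_closedBall 0 1
  let u : E → E := fun x => F x - x
  have huC : ContDiff ℝ 1 u := hF.sub contDiff_id
  have huD : ∀ x, HasFDerivAt u (fderiv ℝ u x) x := fun x =>
    (huC.differentiable one_ne_zero x).hasFDerivAt
  have hu' : Continuous (fderiv ℝ u) := huC.continuous_fderiv one_ne_zero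
  have hdetC : Continuous fun p : ℝ × E => (1 + p.1 • fderiv ℝ u p.2).det := by
    refine ContinuousLinearMap.continuous_det.comp ?_
    exact continuous_const.add (continuous_fst.smul (hu'.comp continuous_snd))
  obtain ⟨K, hK⟩ := huC.contDiffOn.exists_lipschitzOnWith one_ne_zero (convex_closedBall (0 : E) 1)
    hB
  have hpos : ∀ᶠ t : ℝ in 𝓝 0, ∀ x ∈ B, 0 < (1 + t • fderiv ℝ u x).det := by
    refine hB.eventually_forall_of_forall_eventually fun x _ => ?_
    refine hdetC.continuousAt.eventually (lt_mem_nhds ?_)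
    simp [ContinuousLinearMap.det]
  have hsmall : ∀ᶠ t : ℝ in 𝓝 0, t * K < 1 ∧ t < 1 := by
    refine .and ?_ (gt_mem_nhds one_pos)
    refine (continuous_id.mul continuous_const).continuousAt.eventually (gt_mem_nhds ?_)
    simp
  obtain ⟨δ, hδ, hδt⟩ := Metric.eventually_nhds_iff.1 (hpos.and hsmall)
  have hvol : ∀ t : ℝ, 0 < t → t < δ →
      ∫ x in B, (1 + t • fderiv ℝ u x).det = volume.real B := by
    intro t ht htδ
    obtain ⟨hdet, htK, ht1⟩ := hδt (show dist t 0 < δ by simpa [abs_of_pos ht] using htδ)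
    have hbij := bijOn_closedBall_add_smul_sub hK h0
      (fun x _ => by simp [hn x]) ht.le ht1.le htK
    have hcv := integral_image_eq_integral_abs_det_fderiv_smul (volume : Measure E)
      hB.measurableSet (f' := fun x => 1 + t • fderiv ℝ u x)
      (fun x _ => ((hasFDerivAt_id x).add ((huD x).const_smul t)).hasFDerivWithinAt)
      hbij.injOn (fun _ => (1 : ℝ))
    rw [show (id + t • u) '' B = B from hbij.image_eq] at hcv
    simp only [smul_eq_mul, mul_one, integral_const, measureReal_restrict_apply_univ] at hcv
    rw [hcv]
    exact setIntegral_congr_fun hB.measurableSet fun x hx => (abs_of_pos (hdet x hx)).symm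
  obtain ⟨s, v, w, hv, hw, hsum⟩ :=
    exists_affine_combination_det_one_add_smul (E := E) (half_pos hδ)
  have hzero : ∀ x, (1 + fderiv ℝ u x).det = 0 := by
    intro x
    have hFx := hF.differentiable one_ne_zero x
    rw [← det_fderiv_eq_zero_of_norm_eq_one hFx (.of_forall hn)]
    congr 1
    rw [show fderiv ℝ u x = fderiv ℝ F x - 1 from
      (hFx.hasFDerivAt.sub (hasFDerivAt_id x)).fderiv, add_sub_cancel]
  have hint : ∫ x in B, ∑ i ∈ s, w i * (1 + v i • fderiv ℝ u x).det = volume.real B := by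
    rw [integral_finsetSum]
    · simp_rw [integral_const_mul]
      rw [Finset.sum_congr rfl fun i hi => by
        rw [hvol (v i) (hv i hi).1 ((hv i hi).2.trans_lt (half_lt_self hδ))], ← Finset.sum_mul, hw,
        one_mul]
    · intro i _
      exact ((continuous_const.mul (hdetC.comp (continuous_const.prodMk continuous_id))
        ).continuousOn.integrableOn_compact hB)
  simp_rw [← hsum, hzero, integral_zero] at hint
  have hBpos : 0 < volume.real B :=
    ENNReal.toReal_pos (measure_closedBall_pos _ _ one_pos).ne' hB.measure_lt_top.ne
  exact hBpos.ne hint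

/-- A continuous map on the closed unit ball which moves every point by less than `1` has a zero. -/
theorem exists_eq_zero_of_norm_sub_lt_one {G : E → E} (hG : ContinuousOn G (closedBall 0 1))
    (hclose : ∀ x ∈ closedBall (0 : E) 1, ‖G x - x‖ < 1) : ∃ x ∈ closedBall (0 : E) 1, G x = 0 := by
  by_contra! hne
  have hB : IsCompact (closedBall (0 : E) 1) := isCompact_closedBall 0 1
  have hBne : (closedBall (0 : E) 1).Nonempty := ⟨0, by simp⟩
  obtain ⟨a, ha, hamin⟩ := hB.exists_isMinOn hBne hG.norm
  obtain ⟨b, hb, hbmax⟩ := hB.exists_isMaxOn hBne (hG.sub continuousOn_id).norm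
  have hη : 0 < min ‖G a‖ ((1 - ‖G b - b‖) / 2) :=
    lt_min (norm_pos_iff.2 (hne a ha)) (by linarith [hclose b hb])
  set η := min ‖G a‖ ((1 - ‖G b - b‖) / 2) with hηdef
  obtain ⟨G₁, hG₁⟩ := ContinuousMap.exists_restrict_eq isClosed_closedBall
    ⟨_, hG.domRestrict⟩
  obtain ⟨g, hgC, hg, -⟩ := G₁.continuous.exists_contDiff_approx 1 (continuous_const (y := η))
    fun _ => hη
  replace hg : ∀ x ∈ closedBall (0 : E) 1, ‖g x - G x‖ < η := by
    intro x hx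
    have h1 : G₁ x = G x := DFunLike.congr_fun hG₁ (⟨x, hx⟩ : closedBall (0 : E) 1)
    rw [← dist_eq_norm, ← h1]
    exact hg x
  have hgne : ∀ x ∈ closedBall (0 : E) 1, g x ≠ 0 := by
    intro x hx h
    have h1 := hg x hx
    rw [h, zero_sub, norm_neg] at h1
    exact absurd ((hamin hx).trans_lt h1) (not_lt.2 (min_le_left _ _))
  set c : ℝ := (1 + ‖G b - b‖) / 2 with hc
  have hc1 : c < 1 := by linarith [hclose b hb]
  have hc0 : 0 < c := by positivity
  have hgc : ∀ x ∈ closedBall (0 : E) 1, ‖g x - x‖ < c := by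
    intro x hx
    have h1 : ‖G x - x‖ ≤ ‖G b - b‖ := hbmax hx
    have h2 : η ≤ (1 - ‖G b - b‖) / 2 := min_le_right _ _
    linarith [hg x hx, norm_sub_le_norm_sub_add_norm_sub (g x) (G x) x]
  let χ : ContDiffBump (0 : E) := ⟨c, 1, hc0, hc1⟩
  let A : E → E := fun x => x + χ x • (g x - x)
  have hAC : ContDiff ℝ 1 A := contDiff_id.add (χ.contDiff.smul (hgC.sub contDiff_id))
  have hAout : ∀ x, 1 ≤ ‖x‖ → A x = x := by
    intro x hx
    have : χ x = 0 := χ.zero_of_le_dist (by simpa using hx)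
    simp [A, this]
  have hAne : ∀ x, A x ≠ 0 := by
    intro x
    rcases le_or_gt 1 ‖x‖ with hx | hx
    · rw [hAout x hx]
      exact norm_pos_iff.1 (one_pos.trans_le hx)
    have hxB : x ∈ closedBall (0 : E) 1 := by simpa using hx.le
    rcases le_or_gt ‖x‖ c with hxc | hxc
    · have : χ x = 1 := χ.one_of_mem_closedBall (by simpa using hxc)
      simpa [A, this] using hgne x hxB
    · intro h
      have h1 : ‖x‖ = χ x * ‖g x - x‖ := by
        rw [eq_neg_of_add_eq_zero_left h, norm_neg, norm_smul, Real.norm_of_nonneg χ.nonneg,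
          ← eq_neg_of_add_eq_zero_left h]
      have h2 : χ x * ‖g x - x‖ ≤ ‖g x - x‖ :=
        mul_le_of_le_one_left (norm_nonneg _) χ.le_one
      linarith [hgc x hxB]
  obtain ⟨x, hx⟩ := exists_norm_ne_one_of_contDiff (F := fun x => ‖A x‖⁻¹ • A x)
    (((hAC.norm ℝ hAne).inv fun x => norm_ne_zero_iff.2 (hAne x)).smul hAC)
    (fun x hx => by simp [hAout x hx.ge, hx])
  exact hx (norm_smul_inv_norm (𝕜 := ℝ) (hAne x))

/-- A continuous map on a closed ball which moves every point by less than the radius attains the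
center of the ball. -/
theorem exists_eq_center_of_dist_lt {G : E → E} {c : E} {r : ℝ} (hr : 0 < r)
    (hG : ContinuousOn G (closedBall c r)) (hclose : ∀ x ∈ closedBall c r, dist (G x) x < r) :
    ∃ x ∈ closedBall c r, G x = c := by
  have hmaps : MapsTo (fun z : E => c + r • z) (closedBall 0 1) (closedBall c r) := by
    intro z hz
    simpa [norm_smul, abs_of_pos hr] using mul_le_of_le_one_right hr.le (by simpa using hz)
  obtain ⟨z, hz, h⟩ := exists_eq_zero_of_norm_sub_lt_one
    (G := fun z => r⁻¹ • (G (c + r • z) - c))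
    (((hG.comp (by fun_prop) hmaps).sub continuousOn_const).const_smul r⁻¹) (by
      intro z hz
      have h1 : r⁻¹ • (G (c + r • z) - c) - z = r⁻¹ • (G (c + r • z) - (c + r • z)) := by
        rw [← sub_sub, smul_sub _ _ (r • z), inv_smul_smul₀ hr.ne']
      rw [h1, norm_smul, norm_inv, Real.norm_of_nonneg hr.le, inv_mul_lt_one₀ hr, ← dist_eq_norm]
      exact hclose _ (hmaps hz))
  refine ⟨_, hmaps hz, ?_⟩
  simpa [hr.ne', sub_eq_zero] using h

end Inner

/-- Near each point of a metric manifold, every continuous map which is sufficiently close to the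
identity is onto. -/
lemma OpenPartialHomeomorph.exists_nhds_subset_range {E X : Type*} [NormedAddCommGroup E]
    [InnerProductSpace ℝ E] [FiniteDimensional ℝ E] [MetricSpace X]
    (φ : OpenPartialHomeomorph X E) {p : X} (hp : p ∈ φ.source) :
    ∃ U ∈ 𝓝 p, ∃ ε > (0 : ℝ), ∀ f : X → X, Continuous f → (∀ x, dist (f x) x < ε) →
      U ⊆ range f := by
  obtain ⟨R, hR, hRt⟩ := Metric.nhds_basis_closedBall.mem_iff.1
    (φ.open_target.mem_nhds (φ.map_source hp))
  obtain ⟨r, hr, rfl⟩ : ∃ r, 0 < r ∧ r + r = R := ⟨R / 2, half_pos hR, add_halves R⟩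
  have hK : IsCompact (φ.symm '' closedBall (φ p) (r + r)) :=
    (isCompact_closedBall _ _).image_of_continuousOn (φ.continuousOn_symm.mono hRt)
  obtain ⟨ε, hε, hcover⟩ := lebesgue_number_lemma_of_metric hK
    (c := fun z : E => φ.source ∩ φ ⁻¹' ball z (r / 2))
    (fun z => φ.isOpen_inter_preimage isOpen_ball) (by
      rintro _ ⟨y, hy, rfl⟩
      refine mem_iUnion.2 ⟨y, φ.map_target (hRt hy), ?_⟩
      simpa [φ.right_inv (hRt hy)] using hr)
  refine ⟨φ.source ∩ φ ⁻¹' ball (φ p) r, (φ.isOpen_inter_preimage isOpen_ball).mem_nhds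
    ⟨hp, by simpa using hr⟩, ε, hε, fun f hf hfε q hq => ?_⟩
  have hsub : closedBall (φ q) r ⊆ closedBall (φ p) (r + r) :=
    closedBall_subset_closedBall' (by linarith [mem_ball.1 hq.2])
  have hlocal : ∀ x ∈ closedBall (φ q) r, f (φ.symm x) ∈ φ.source ∧
      dist (φ (f (φ.symm x))) x < r := by
    intro x hx
    obtain ⟨z, hz⟩ := hcover _ (mem_image_of_mem φ.symm (hsub hx))
    have h1 := hz (mem_ball.2 (hfε (φ.symm x)))
    have h2 := (hz (mem_ball_self hε)).2
    rw [mem_preimage, φ.right_inv (hRt (hsub hx)), mem_ball] at h2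
    refine ⟨h1.1, (dist_triangle_right _ _ z).trans_lt ?_⟩
    linarith [mem_ball.1 h1.2]
  obtain ⟨x, hx, hxq⟩ := exists_eq_center_of_dist_lt (G := fun x => φ (f (φ.symm x))) hr
    (φ.continuousOn.comp (hf.comp_continuousOn (φ.continuousOn_symm.mono (hsub.trans hRt)))
      fun x hx => (hlocal x hx).1)
    fun x hx => (hlocal x hx).2
  exact ⟨_, φ.injOn (hlocal x hx).1 hq.1 hxq⟩

/-- On a compact metric topological `n`-manifold (without boundary),
every continuous map sufficiently `C⁰`-close to the identity is surjective. -/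
theorem close_to_id_surjective {n : ℕ} {X : Type}
    [MetricSpace X] [CompactSpace X]
    [ChartedSpace (EuclideanSpace ℝ (Fin n)) X] :
    ∃ ε > (0 : ℝ), ∀ f : X → X, Continuous f →
      (∀ x : X, dist (f x) x < ε) → Function.Surjective f := by
  suffices h : ∃ ε > (0 : ℝ), ∀ f : X → X, Continuous f → (∀ x, dist (f x) x < ε) →
      univ ⊆ range f by
    simpa only [univ_subset_iff, range_eq_univ] using h
  refine isCompact_univ.induction_on (p := fun s => ∃ ε > (0 : ℝ), ∀ f : X → X, Continuous f →
    (∀ x, dist (f x) x < ε) → s ⊆ range f) ⟨1, one_pos, by simp⟩ ?_ ?_ fun p _ => ?_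
  · rintro s t hst ⟨ε, hε, h⟩
    exact ⟨ε, hε, fun f hf hfε => hst.trans (h f hf hfε)⟩
  · rintro s t ⟨ε, hε, h⟩ ⟨ε', hε', h'⟩
    exact ⟨min ε ε', lt_min hε hε', fun f hf hfε => union_subset
      (h f hf fun x => (hfε x).trans_le (min_le_left _ _))
      (h' f hf fun x => (hfε x).trans_le (min_le_right _ _))⟩
  · obtain ⟨U, hU, h⟩ := (chartAt (EuclideanSpace ℝ (Fin n)) p).exists_nhds_subset_range
      (mem_chart_source _ p)
    exact ⟨U, mem_nhdsWithin_of_mem_nhds hU, h⟩
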